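/- Suppose the random walk is non-singular, M_x < 0 or M_y < 0, h(0) < 1, v(0) < 1 and h(1) + p(1,-1) > 0; suppose Γ is infinite, every (ρ,σ) ∈ Γ satisfies Q(ρ,σ) = 0, and Γ satisfies the separation condition; suppose the induced measure m is positive, satisfies the interior balance equations, the horizontal balance equations and the vertical balance equations, and that the invariant measure is unique up to scaling. Then at least one coefficient is negative: there exists (ρ,σ) ∈ Γ with α(ρ,σ) < 0. -/

import Mathlib

open Finset

/-- The index set `{-1, 0, 1}` for the jumps of the random walk. -/
def II : Finset ℤ := {-1, 0, 1}

/-- The kernel `Q(x,y) = ∑_{s,t ∈ {-1,0,1}} p(s,t) x^{1-s} y^{1-t} − x y`. -/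
noncomputable def Qf (p : ℤ → ℤ → ℝ) (x y : ℝ) : ℝ :=
  (∑ s ∈ II, ∑ t ∈ II, p s t * x ^ (1 - s).toNat * y ^ (1 - t).toNat) - x * y

/-- The kernel as an element of the polynomial ring `ℝ[x,y]`;
variable `0` is `x` and variable `1` is `y`. -/
noncomputable def Qpoly (p : ℤ → ℤ → ℝ) : MvPolynomial (Fin 2) ℝ :=
  (∑ s ∈ II, ∑ t ∈ II, MvPolynomial.C (p s t) *
      MvPolynomial.X 0 ^ (1 - s).toNat * MvPolynomial.X 1 ^ (1 - t).toNat)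
    - MvPolynomial.X 0 * MvPolynomial.X 1

/-- The random walk is non-singular if `Q` is irreducible in `ℝ[x,y]`
and of degree 2 in each of the two variables. -/
def Nonsingular (p : ℤ → ℤ → ℝ) : Prop :=
  Irreducible (Qpoly p) ∧ (Qpoly p).degreeOf 0 = 2 ∧ (Qpoly p).degreeOf 1 = 2

/-- Horizontal mean drift. -/
noncomputable def Mx (p : ℤ → ℤ → ℝ) : ℝ := ∑ t ∈ II, (p 1 t - p (-1) t)

/-- Vertical mean drift. -/
noncomputable def My (p : ℤ → ℤ → ℝ) : ℝ := ∑ s ∈ II, (p s 1 - p s (-1))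

/-- The measure on `ℕ × ℕ` induced by the set of geometric terms `Γ`
with coefficients `α`. -/
noncomputable def inducedMeasure (Γ : Set (ℝ × ℝ)) (α : ℝ × ℝ → ℝ) (i j : ℕ) : ℝ :=
  ∑' q : Γ, α q * (q : ℝ × ℝ).1 ^ i * (q : ℝ × ℝ).2 ^ j

/-- The absolute-convergence assumption on the coefficients. -/
def AbsConv (Γ : Set (ℝ × ℝ)) (α : ℝ × ℝ → ℝ) : Prop :=
  Summable (fun q : Γ => |α q| * (1 - (q : ℝ × ℝ).1)⁻¹ * (1 - (q : ℝ × ℝ).2)⁻¹)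

/-- The separation condition on `Γ`. -/
def Separation (Γ : Set (ℝ × ℝ)) : Prop :=
  ∀ q ∈ Γ, ∃ w v : ℕ, 0 < w ∧ 0 < v ∧
    ∀ q' ∈ Γ, q' ≠ q → q'.1 ^ w * q'.2 ^ v ≠ q.1 ^ w * q.2 ^ v

/-- The interior balance equations for a measure `m` on `ℕ × ℕ`. -/
def InteriorBalance (p : ℤ → ℤ → ℝ) (m : ℕ → ℕ → ℝ) : Prop :=
  ∀ i j : ℕ, 1 ≤ i → 1 ≤ j →
    m i j = ∑ s ∈ II, ∑ t ∈ II, m ((i : ℤ) - s).toNat ((j : ℤ) - t).toNat * p s t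

/-- The horizontal balance equations for a measure `m` on `ℕ × ℕ`. -/
def HorizontalBalance (p : ℤ → ℤ → ℝ) (h : ℤ → ℝ) (m : ℕ → ℕ → ℝ) : Prop :=
  ∀ i : ℕ, 1 ≤ i →
    m i 0 = (∑ s ∈ II, m ((i : ℤ) - s).toNat 1 * p s (-1)) +
      ∑ s ∈ II, m ((i : ℤ) - s).toNat 0 * h s

/-- The vertical balance equations for a measure `m` on `ℕ × ℕ`. -/
def VerticalBalance (p : ℤ → ℤ → ℝ) (v : ℤ → ℝ) (m : ℕ → ℕ → ℝ) : Prop :=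
  ∀ j : ℕ, 1 ≤ j →
    m 0 j = (∑ t ∈ II, m 1 ((j : ℤ) - t).toNat * p (-1) t) +
      ∑ t ∈ II, m 0 ((j : ℤ) - t).toNat * v t

/-- Uniqueness of the invariant measure up to scaling. -/
def UniqueInvariant (p : ℤ → ℤ → ℝ) (h v : ℤ → ℝ) (m : ℕ → ℕ → ℝ) : Prop :=
  ∀ m' : ℕ → ℕ → ℝ, (∀ i j, 0 ≤ m' i j) → (∃ i j, m' i j ≠ 0) →
    Summable (fun ij : ℕ × ℕ => m' ij.1 ij.2) →
    InteriorBalance p m' → HorizontalBalance p h m' → VerticalBalance p v m' →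
    ∃ c : ℝ, 0 < c ∧ ∀ i j, m' i j = c * m i j
theorem exists_opposite_of_hasSum_zero {ι : Type*} {a x g : ι → ℝ} (ha : ∀ k, 0 < a k)
    (hx : ∀ k, x k ∈ Set.Ioo (0 : ℝ) 1)
    (hz : ∀ n : ℕ, HasSum (fun k => a k * g k * x k ^ n) 0) (k : ι) (hk : g k ≠ 0) :
    ∃ l, x l = x k ∧ g l * g k < 0 := by
  classical
  by_contra! hcon
  have hpoly : ∀ P : Polynomial ℝ, HasSum (fun l => a l * g l * P.eval (x l)) 0 := by
    intro P
    induction P using Polynomial.induction_on' with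
    | add P R hP hR =>
      simpa [mul_add] using hP.add hR
    | monomial n c =>
      simpa [mul_comm, mul_left_comm, mul_assoc] using (hz n).mul_left c
  have hsum : Summable fun l => |a l * g l| := by
    simpa using (hz 0).summable.abs
  have hlim := tendsto_tsum_of_dominated_convergence (𝓕 := Filter.atTop) hsum
    (f := fun (n : ℕ) l => a l * g l * (1 - (x l - x k) ^ 2) ^ n)
    (g := fun l => if x l = x k then a l * g l else 0)
    (by
      intro l
      split_ifs with h
      · simp [h]
      · have h1 : 0 < (x l - x k) ^ 2 := by
          have := sub_ne_zero.mpr h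
          positivity
        have h2 : (x l - x k) ^ 2 < 1 := by
          have := hx l; have := hx k
          simp only [Set.mem_Ioo] at *
          nlinarith
        simpa using (tendsto_pow_atTop_nhds_zero_of_lt_one (by linarith) (by linarith :
          1 - (x l - x k) ^ 2 < 1)).const_mul (a l * g l))
    (by
      refine Filter.Eventually.of_forall fun n l => ?_
      have h2 : (x l - x k) ^ 2 < 1 := by
        have := hx l; have := hx k
        simp only [Set.mem_Ioo] at *
        nlinarith
      rw [norm_mul, Real.norm_eq_abs, Real.norm_eq_abs, abs_pow]
      refine mul_le_of_le_one_right (abs_nonneg _) (pow_le_one₀ (abs_nonneg _) ?_)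
      rw [abs_le]
      constructor <;> nlinarith [sq_nonneg (x l - x k)])
  have hzero : ∀ n : ℕ, ∑' l, a l * g l * (1 - (x l - x k) ^ 2) ^ n = 0 := by
    intro n
    have := (hpoly ((1 - (Polynomial.X - Polynomial.C (x k)) ^ 2) ^ n)).tsum_eq
    simpa using this
  simp only [hzero] at hlim
  have h0 := tendsto_nhds_unique hlim tendsto_const_nhds
  have hs : Summable fun l => if x l = x k then a l * g l else 0 := by
    refine Summable.of_norm_bounded hsum fun l => ?_
    split_ifs
    · simp
    · simp only [norm_zero]
      positivity
  have hpos : 0 < ∑' l, (if x l = x k then a l * g l else 0) * g k := by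
    refine (hs.mul_right (g k)).tsum_pos (fun l => ?_) k ?_
    · split_ifs with h
      · rw [mul_assoc]
        exact mul_nonneg (ha l).le (hcon l h)
      · simp
    · rw [if_pos rfl, mul_assoc]
      exact mul_pos (ha k) (mul_self_pos.mpr hk)
  rw [tsum_mul_right, h0, zero_mul] at hpos
  exact lt_irrefl _ hpos

theorem sum_II (f : ℤ → ℝ) : ∑ s ∈ II, f s = f (-1) + f 0 + f 1 := by
  simp [II, add_assoc]

/-- The kernel of the random walk reflected in the diagonal. -/
def reflectKernel (p : ℤ → ℤ → ℝ) : ℤ → ℤ → ℝ := fun s t => p t s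

/-- The coefficient of `y²` in the kernel `Q`. -/
def quadCoeff (p : ℤ → ℤ → ℝ) (x : ℝ) : ℝ := p 1 (-1) + p 0 (-1) * x + p (-1) (-1) * x ^ 2

/-- The coefficient of `y` in the kernel `Q`. -/
def linCoeff (p : ℤ → ℤ → ℝ) (x : ℝ) : ℝ := p 1 0 + (p 0 0 - 1) * x + p (-1) 0 * x ^ 2

/-- The coefficient of `1` in the kernel `Q`, as a polynomial in `y`. -/
def constCoeff (p : ℤ → ℤ → ℝ) (x : ℝ) : ℝ := p 1 1 + p 0 1 * x + p (-1) 1 * x ^ 2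

/-- The derivative of the kernel `Q` in `y`. -/
def kernelDeriv (p : ℤ → ℤ → ℝ) (x y : ℝ) : ℝ := 2 * quadCoeff p x * y + linCoeff p x

/-- The part of the horizontal boundary kernel that does not involve `y`, with its sign reversed. -/
def boundaryPoly (h : ℤ → ℝ) (x : ℝ) : ℝ := x - h 1 - h 0 * x - h (-1) * x ^ 2

/-- The kernel of the horizontal balance equations. -/
def boundaryKernel (p : ℤ → ℤ → ℝ) (h : ℤ → ℝ) (x y : ℝ) : ℝ :=
  quadCoeff p x * y - boundaryPoly h x

/-- The resultant in `y` of the kernel and the horizontal boundary kernel, up to a factor. -/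
def boundaryResultant (p : ℤ → ℤ → ℝ) (h : ℤ → ℝ) (x : ℝ) : ℝ :=
  boundaryPoly h x ^ 2 + linCoeff p x * boundaryPoly h x + quadCoeff p x * constCoeff p x

/-- The involution exchanging the two roots of the kernel in `y`. -/
noncomputable def flip₂ (p : ℤ → ℤ → ℝ) (q : ℝ × ℝ) : ℝ × ℝ :=
  (q.1, -q.2 - linCoeff p q.1 / quadCoeff p q.1)

/-- The involution exchanging the two roots of the kernel in `x`. -/
noncomputable def flip₁ (p : ℤ → ℤ → ℝ) (q : ℝ × ℝ) : ℝ × ℝ :=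
  (-q.1 - linCoeff (reflectKernel p) q.2 / quadCoeff (reflectKernel p) q.2, q.2)

theorem Qf_eq (p : ℤ → ℤ → ℝ) (x y : ℝ) :
    Qf p x y = quadCoeff p x * y ^ 2 + linCoeff p x * y + constCoeff p x := by
  have h1 : (1 - (1 : ℤ)).toNat = 0 := rfl
  have h2 : (1 - (0 : ℤ)).toNat = 1 := rfl
  have h3 : (1 - (-1 : ℤ)).toNat = 2 := rfl
  simp only [Qf, sum_II, h1, h2, h3, quadCoeff, linCoeff, constCoeff]
  ring

theorem Qf_reflectKernel (p : ℤ → ℤ → ℝ) (x y : ℝ) : Qf (reflectKernel p) y x = Qf p x y := by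
  simp only [Qf_eq, quadCoeff, linCoeff, constCoeff, reflectKernel]
  ring

theorem eval_Qpoly (p : ℤ → ℤ → ℝ) (z : Fin 2 → ℝ) :
    MvPolynomial.eval z (Qpoly p) = Qf p (z 0) (z 1) := by
  simp [Qpoly, Qf]

theorem Nonsingular.reflectKernel {p : ℤ → ℤ → ℝ} (hns : Nonsingular p) :
    Nonsingular (reflectKernel p) := by
  have hren : Qpoly (_root_.reflectKernel p) =
      MvPolynomial.renameEquiv ℝ (Equiv.swap (0 : Fin 2) 1) (Qpoly p) := by
    apply MvPolynomial.funext
    intro z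
    rw [eval_Qpoly, MvPolynomial.renameEquiv_apply, MvPolynomial.eval_rename, eval_Qpoly,
      Qf_reflectKernel]
    simp
  obtain ⟨hirr, hx, hy⟩ := hns
  have hinj := (Equiv.swap (0 : Fin 2) 1).injective
  refine ⟨?_, ?_, ?_⟩
  · rw [hren, MulEquiv.irreducible_iff]
    exact hirr
  · rw [hren, MvPolynomial.renameEquiv_apply]
    simpa [hy] using MvPolynomial.degreeOf_rename_of_injective (p := Qpoly p) hinj 1
  · rw [hren, MvPolynomial.renameEquiv_apply]
    simpa [hx] using MvPolynomial.degreeOf_rename_of_injective (p := Qpoly p) hinj 0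

open MvPolynomial in
theorem degreeOf_one_affine_le (a b c d e f : ℝ) :
    degreeOf 1 ((C a + C b * X 0 + C c * X 0 ^ 2) * X 1 +
      (C d + C e * X 0 + C f * X 0 ^ 2) : MvPolynomial (Fin 2) ℝ) ≤ 1 := by
  have h0 : ∀ a b c : ℝ,
      degreeOf 1 (C a + C b * X 0 + C c * X 0 ^ 2 : MvPolynomial (Fin 2) ℝ) ≤ 0 := by
    intro a b c
    refine (degreeOf_add_le _ _ _).trans (max_le ((degreeOf_add_le _ _ _).trans (max_le ?_ ?_)) ?_)
    · rw [degreeOf_C]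
    · exact (degreeOf_C_mul_le _ _ _).trans (degreeOf_X_of_ne (by decide)).le
    · exact (degreeOf_C_mul_le _ _ _).trans (degreeOf_X_pow_of_ne _ (by decide)).le
  refine (degreeOf_add_le _ _ _).trans (max_le ((degreeOf_mul_le _ _ _).trans ?_) ?_)
  · have := h0 a b c
    have h1 : degreeOf 1 (X 1 : MvPolynomial (Fin 2) ℝ) = 1 := degreeOf_X_self 1
    omega
  · exact (h0 d e f).trans zero_le_one

open MvPolynomial in
theorem Nonsingular.exists_quadCoeff_ne_zero {p : ℤ → ℤ → ℝ} (hns : Nonsingular p) :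
    ∃ x, quadCoeff p x ≠ 0 := by
  by_contra! hcon
  have heq : Qpoly p = (C (p 1 0) + C (p 0 0 - 1) * X 0 + C (p (-1) 0) * X 0 ^ 2) * X 1 +
      (C (p 1 1) + C (p 0 1) * X 0 + C (p (-1) 1) * X 0 ^ 2) := by
    apply MvPolynomial.funext
    intro z
    rw [eval_Qpoly, Qf_eq, hcon]
    simp [linCoeff, constCoeff]
  have h1 := degreeOf_one_affine_le (p 1 0) (p 0 0 - 1) (p (-1) 0) (p 1 1) (p 0 1) (p (-1) 1)
  rw [← heq, hns.2.2] at h1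
  omega

theorem Nonsingular.quadCoeff_pos {p : ℤ → ℤ → ℝ} (hp : ∀ s ∈ II, ∀ t ∈ II, 0 ≤ p s t)
    (hns : Nonsingular p) {x : ℝ} (hx : 0 < x) : 0 < quadCoeff p x := by
  obtain ⟨z, hz⟩ := hns.exists_quadCoeff_ne_zero
  have h1 := hp 1 (by simp [II]) (-1) (by simp [II])
  have h2 := hp 0 (by simp [II]) (-1) (by simp [II])
  have h3 := hp (-1) (by simp [II]) (-1) (by simp [II])
  have h0 : 0 ≤ quadCoeff p x := by unfold quadCoeff; positivity
  refine h0.lt_of_ne fun h => hz ?_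
  unfold quadCoeff at *
  have e1 : p 1 (-1) = 0 := by nlinarith [mul_nonneg h2 hx.le, mul_nonneg h3 (sq_nonneg x)]
  have e2 : p 0 (-1) * x = 0 := by nlinarith [mul_nonneg h2 hx.le, mul_nonneg h3 (sq_nonneg x)]
  have e3 : p (-1) (-1) * x ^ 2 = 0 := by nlinarith
  have e2' : p 0 (-1) = 0 := by simpa [hx.ne'] using e2
  have e3' : p (-1) (-1) = 0 := by simpa [hx.ne'] using e3
  simp [e1, e2', e3']

open MvPolynomial in
theorem Nonsingular.Qf_zero_left_ne_zero {p : ℤ → ℤ → ℝ} (hp : ∀ s ∈ II, ∀ t ∈ II, 0 ≤ p s t)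
    (hns : Nonsingular p) {y : ℝ} (hy : 0 < y) : Qf p 0 y ≠ 0 := by
  intro h
  have h1 := hp 1 (by simp [II]) (-1) (by simp [II])
  have h2 := hp 1 (by simp [II]) 0 (by simp [II])
  have h3 := hp 1 (by simp [II]) 1 (by simp [II])
  rw [Qf_eq] at h
  simp only [quadCoeff, linCoeff, constCoeff, mul_zero, add_zero, ne_eq, OfNat.ofNat_ne_zero,
    not_false_eq_true, zero_pow] at h
  have e3 : p 1 1 = 0 := by nlinarith [mul_nonneg h1 (sq_nonneg y), mul_nonneg h2 hy.le]
  have e2 : p 1 0 * y = 0 := by nlinarith [mul_nonneg h1 (sq_nonneg y), mul_nonneg h2 hy.le]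
  have e1 : p 1 (-1) * y ^ 2 = 0 := by linarith
  have e2' : p 1 0 = 0 := by simpa [hy.ne'] using e2
  have e1' : p 1 (-1) = 0 := by simpa [hy.ne'] using e1
  obtain ⟨R, hR⟩ : ∃ R, Qpoly p = X 0 * R := by
    refine ⟨C (p 0 (-1)) * X 1 ^ 2 + C (p (-1) (-1)) * X 0 * X 1 ^ 2 + C (p 0 0 - 1) * X 1 +
      C (p (-1) 0) * X 0 * X 1 + C (p 0 1) + C (p (-1) 1) * X 0, ?_⟩
    apply MvPolynomial.funext
    intro z
    rw [eval_Qpoly, Qf_eq]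
    simp [quadCoeff, linCoeff, constCoeff, e1', e2', e3]
    ring
  have hX : ¬ IsUnit (X 0 : MvPolynomial (Fin 2) ℝ) := (MvPolynomial.X_prime (R := ℝ)).not_isUnit
  have hunit := (hns.1.isUnit_or_isUnit hR).resolve_left hX
  obtain ⟨r, -, rfl⟩ := MvPolynomial.isUnit_iff_eq_C_of_isReduced.mp hunit
  have hdeg := hns.2.2
  rw [hR, mul_comm] at hdeg
  have := (degreeOf_C_mul_le (X 0 : MvPolynomial (Fin 2) ℝ) 1 r).trans
    (degreeOf_X_of_ne (by decide)).le
  omega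

open MvPolynomial in
theorem Nonsingular.exists_boundaryResultant_ne_zero {p : ℤ → ℤ → ℝ} (hns : Nonsingular p)
    (h : ℤ → ℝ) : ∃ x, boundaryResultant p h x ≠ 0 := by
  by_contra! hcon
  obtain ⟨w, hw⟩ := hns.exists_quadCoeff_ne_zero
  let A : MvPolynomial (Fin 2) ℝ :=
    C (p 1 (-1)) + C (p 0 (-1)) * X 0 + C (p (-1) (-1)) * X 0 ^ 2
  let L (a b c : ℝ) : MvPolynomial (Fin 2) ℝ := A * X 1 + (C a + C b * X 0 + C c * X 0 ^ 2)
  have hnd : ∀ a b c : ℝ, ¬ Qpoly p ∣ L a b c := by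
    rintro a b c ⟨R, hR⟩
    by_cases hL : L a b c = 0
    · apply hw
      have e1 := congrArg (eval ![w, 1]) hL
      have e0 := congrArg (eval ![w, 0]) hL
      simp [L, A] at e1 e0
      unfold quadCoeff
      linarith
    · have hdeg : degreeOf 1 (L a b c) ≤ 1 := degreeOf_one_affine_le _ _ _ _ _ _
      have hne : Qpoly p ≠ 0 := hns.1.ne_zero
      have hR0 : R ≠ 0 := by
        rintro rfl
        exact hL (by simpa using hR)
      rw [hR, degreeOf_mul_eq hne hR0, hns.2.2] at hdeg
      omega
  have hfac : A * Qpoly p = L (h 1) (h 0 - 1) (h (-1)) *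
      L (p 1 0 - h 1) (p 0 0 - h 0) (p (-1) 0 - h (-1)) := by
    apply MvPolynomial.funext
    intro z
    have e := hcon (z 0)
    simp only [boundaryResultant, boundaryPoly] at e
    rw [map_mul, eval_Qpoly, Qf_eq]
    have hA : eval z A = quadCoeff p (z 0) := by simp [A, quadCoeff]
    simp only [L, map_mul, map_add, hA, eval_X, eval_C, map_pow]
    simp only [linCoeff] at e ⊢
    linear_combination e
  rcases hns.1.prime.dvd_or_dvd (Dvd.intro_left _ hfac) with hd | hd
  · exact hnd _ _ _ hd
  · exact hnd _ _ _ hd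

theorem Nonsingular.finite_boundaryResultant_eq_zero {p : ℤ → ℤ → ℝ} (hns : Nonsingular p)
    (h : ℤ → ℝ) : {x | boundaryResultant p h x = 0}.Finite := by
  let P (a b c : ℝ) : Polynomial ℝ :=
    Polynomial.C a + Polynomial.C b * Polynomial.X + Polynomial.C c * Polynomial.X ^ 2
  let N := P (-h 1) (1 - h 0) (-h (-1))
  let F := N ^ 2 + P (p 1 0) (p 0 0 - 1) (p (-1) 0) * N +
    P (p 1 (-1)) (p 0 (-1)) (p (-1) (-1)) * P (p 1 1) (p 0 1) (p (-1) 1)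
  have hF : ∀ x, F.eval x = boundaryResultant p h x := by
    intro x
    simp [F, N, P, boundaryResultant, boundaryPoly, linCoeff, quadCoeff, constCoeff]
    ring
  obtain ⟨x, hx⟩ := hns.exists_boundaryResultant_ne_zero h
  have hF0 : F ≠ 0 := by
    intro h0
    apply hx
    rw [← hF, h0, Polynomial.eval_zero]
  refine (Polynomial.finite_setOfPred_isRoot hF0).subset fun x hx => ?_
  rw [Set.mem_ofPred_eq] at hx ⊢
  rw [Polynomial.IsRoot, hF, hx]

theorem mul_eq_pow_mul_exp {s t : ℤ} (hs : s ∈ II) (ht : t ∈ II) {x y : ℝ} (hx : 0 < x)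
    (hy : 0 < y) : x * y = x ^ (1 - s).toNat * y ^ (1 - t).toNat *
      Real.exp (s * Real.log x + t * Real.log y) := by
  have key : ∀ {r : ℤ} {z : ℝ}, r ∈ II → 0 < z →
      z = z ^ (1 - r).toNat * Real.exp (r * Real.log z) := by
    intro r z hr hz
    simp only [II, Finset.mem_insert, Finset.mem_singleton] at hr
    have hcast : (((1 - r).toNat : ℕ) : ℝ) = 1 - r := by
      have h0 : (((1 - r).toNat : ℕ) : ℤ) = 1 - r := Int.toNat_of_nonneg (by omega)
      exact_mod_cast h0
    conv_rhs =>
      rw [← Real.exp_log hz, ← Real.exp_nat_mul, ← Real.exp_add, Real.log_exp, hcast]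
    rw [← add_mul, sub_add_cancel, one_mul, Real.exp_log hz]
  rw [Real.exp_add]
  nth_rewrite 1 [key hs hx, key ht hy]
  ring

/-- The gap in the convexity inequality `1 + log z ≤ z`, applied to one jump of the walk. -/
noncomputable def convexityGap (p : ℤ → ℤ → ℝ) (x y : ℝ) (s t : ℤ) : ℝ :=
  p s t * (x * y) - p s t * x ^ (1 - s).toNat * y ^ (1 - t).toNat *
    (1 + s * Real.log x + t * Real.log y)

section Convexity

variable {p : ℤ → ℤ → ℝ} {x y : ℝ}

theorem convexityGap_eq {s t : ℤ} (hs : s ∈ II) (ht : t ∈ II) (hx : 0 < x) (hy : 0 < y) :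
    convexityGap p x y s t = p s t * x ^ (1 - s).toNat * y ^ (1 - t).toNat *
      (Real.exp (s * Real.log x + t * Real.log y) - (s * Real.log x + t * Real.log y + 1)) := by
  unfold convexityGap
  linear_combination p s t * mul_eq_pow_mul_exp hs ht hx hy

theorem convexityGap_nonneg (hp : ∀ s ∈ II, ∀ t ∈ II, 0 ≤ p s t) {s t : ℤ} (hs : s ∈ II)
    (ht : t ∈ II) (hx : 0 < x) (hy : 0 < y) : 0 ≤ convexityGap p x y s t := by
  rw [convexityGap_eq hs ht hx hy]
  have := hp s hs t ht
  have := sub_nonneg.mpr (Real.add_one_le_exp (s * Real.log x + t * Real.log y))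
  positivity

theorem mul_eq_of_convexityGap_eq_zero {s t : ℤ} (hs : s ∈ II) (ht : t ∈ II) (hx : 0 < x)
    (hy : 0 < y) (h : convexityGap p x y s t = 0) :
    p s t * (x * y) = p s t * x ^ (1 - s).toNat * y ^ (1 - t).toNat := by
  have h' := h
  rw [convexityGap_eq hs ht hx hy, mul_eq_zero] at h'
  rcases h' with h' | h'
  · rw [h']
    have : p s t = 0 := by
      simpa [mul_assoc, hx.ne', hy.ne'] using h'
    simp [this]
  · have h0 : (s : ℝ) * Real.log x + t * Real.log y = 0 := by
      by_contra hne
      linarith [Real.add_one_lt_exp hne]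
    rw [mul_eq_pow_mul_exp hs ht hx hy, h0, Real.exp_zero]
    ring

theorem sum_convexityGap (hp1 : ∑ s ∈ II, ∑ t ∈ II, p s t = 1) (hQ : Qf p x y = 0) :
    ∑ s ∈ II, ∑ t ∈ II, convexityGap p x y s t =
      x * kernelDeriv (reflectKernel p) y x * Real.log x +
        y * kernelDeriv p x y * Real.log y := by
  have h1 : (1 - (1 : ℤ)).toNat = 0 := rfl
  have h2 : (1 - (0 : ℤ)).toNat = 1 := rfl
  have h3 : (1 - (-1 : ℤ)).toNat = 2 := rfl
  rw [Qf_eq] at hQ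
  simp only [sum_II, convexityGap, h1, h2, h3, kernelDeriv, quadCoeff, linCoeff, constCoeff,
    reflectKernel] at *
  push_cast
  linear_combination (x * y) * hp1 - (1 + Real.log x + Real.log y) * hQ

theorem drift_eq_zero_of_kernelDeriv_eq_zero (hp : ∀ s ∈ II, ∀ t ∈ II, 0 ≤ p s t)
    (hp1 : ∑ s ∈ II, ∑ t ∈ II, p s t = 1) (hx : 0 < x) (hy : 0 < y) (hQ : Qf p x y = 0)
    (hQx : kernelDeriv (reflectKernel p) y x = 0) (hQy : kernelDeriv p x y = 0) :
    Mx p = 0 ∧ My p = 0 := by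
  have hsum := sum_convexityGap hp1 hQ
  rw [hQx, hQy] at hsum
  simp only [mul_zero, zero_mul, add_zero] at hsum
  have hterm : ∀ s ∈ II, ∀ t ∈ II,
      p s t * (x * y) = p s t * x ^ (1 - s).toNat * y ^ (1 - t).toNat := by
    intro s hs t ht
    refine mul_eq_of_convexityGap_eq_zero hs ht hx hy ?_
    have hrow := (Finset.sum_eq_zero_iff_of_nonneg fun s hs =>
      Finset.sum_nonneg fun t ht => convexityGap_nonneg hp hs ht hx hy).mp hsum s hs
    exact (Finset.sum_eq_zero_iff_of_nonneg fun t ht =>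
      convexityGap_nonneg hp hs ht hx hy).mp hrow t ht
  have h1 : (1 - (1 : ℤ)).toNat = 0 := rfl
  have h2 : (1 - (0 : ℤ)).toNat = 1 := rfl
  have h3 : (1 - (-1 : ℤ)).toNat = 2 := rfl
  simp only [II, Finset.mem_insert, Finset.mem_singleton, forall_eq_or_imp, forall_eq, h1, h2, h3]
    at hterm
  obtain ⟨⟨e1, e2, e3⟩, ⟨e4, e5, e6⟩, ⟨e7, e8, e9⟩⟩ := hterm
  have hxy : x * y ≠ 0 := (mul_pos hx hy).ne'
  rw [Qf_eq] at hQ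
  simp only [Mx, My, sum_II, kernelDeriv, quadCoeff, linCoeff, constCoeff, reflectKernel] at *
  constructor
  · apply mul_left_cancel₀ hxy
    linear_combination hQ - x * hQx - e1 - e2 - e3 + e7 + e8 + e9
  · apply mul_left_cancel₀ hxy
    linear_combination hQ - y * hQy - e1 - e4 - e7 + e3 + e6 + e9

theorem kernelDeriv_neg_or_neg (hp : ∀ s ∈ II, ∀ t ∈ II, 0 ≤ p s t)
    (hp1 : ∑ s ∈ II, ∑ t ∈ II, p s t = 1) (hdrift : Mx p ≠ 0 ∨ My p ≠ 0)
    (hx : x ∈ Set.Ioo (0 : ℝ) 1) (hy : y ∈ Set.Ioo (0 : ℝ) 1) (hQ : Qf p x y = 0) :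
    kernelDeriv (reflectKernel p) y x < 0 ∨ kernelDeriv p x y < 0 := by
  by_contra! hcon
  have hsum := sum_convexityGap hp1 hQ
  have h0 : 0 ≤ ∑ s ∈ II, ∑ t ∈ II, convexityGap p x y s t :=
    Finset.sum_nonneg fun s hs => Finset.sum_nonneg fun t ht =>
      convexityGap_nonneg hp hs ht hx.1 hy.1
  have hlx := Real.log_neg hx.1 hx.2
  have hly := Real.log_neg hy.1 hy.2
  have ex := mul_nonpos_of_nonneg_of_nonpos (mul_nonneg hx.1.le hcon.1) hlx.le
  have ey := mul_nonpos_of_nonneg_of_nonpos (mul_nonneg hy.1.le hcon.2) hly.le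
  have ex0 : x * kernelDeriv (reflectKernel p) y x * Real.log x = 0 := by linarith
  have ey0 : y * kernelDeriv p x y * Real.log y = 0 := by linarith
  simp only [mul_eq_zero, hx.1.ne', hlx.ne, false_or, or_false] at ex0
  simp only [mul_eq_zero, hy.1.ne', hly.ne, false_or, or_false] at ey0
  have := drift_eq_zero_of_kernelDeriv_eq_zero hp hp1 hx.1 hy.1 hQ ex0 ey0
  tauto

end Convexity

theorem eq_zero_of_forall_pos_le {a : ℝ} (ha : 0 ≤ a) (h : ∀ ε > 0, a ≤ ε) : a = 0 :=
  le_antisymm (le_of_forall_pos_le_add fun ε hε => by simpa using h ε hε) ha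

theorem boundaryResultant_ne_zero {p : ℤ → ℤ → ℝ} (hp : ∀ s ∈ II, ∀ t ∈ II, 0 ≤ p s t)
    (hp1 : ∑ s ∈ II, ∑ t ∈ II, p s t = 1) {h : ℤ → ℝ} (hh : ∀ s ∈ II, 0 ≤ h s)
    (hh1 : h (-1) + h 0 + h 1 + p (-1) 1 + p 0 1 + p 1 1 = 1)
    (hnear : ∀ ε > 0, ∃ x y, x ∈ Set.Ioo 0 ε ∧ y ∈ Set.Ioo 0 ε ∧ Qf p x y = 0 ∧
      boundaryResultant p h x < 0) {z : ℝ} (hz : z ∈ Set.Ioo (0 : ℝ) 1) :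
    boundaryResultant p h z ≠ 0 := by
  simp only [II, Finset.mem_insert, Finset.mem_singleton, forall_eq_or_imp, forall_eq] at hp hh
  obtain ⟨⟨g0, d0, c0⟩, ⟨e0, p000, p010⟩, ⟨a0, p100, p110⟩⟩ := hp
  obtain ⟨η0, h00, h10⟩ := hh
  simp only [sum_II] at hp1
  simp only [Qf_eq, boundaryResultant] at *
  have hcorner : ∀ ε > 0, p 1 1 ≤ ε ∧ p 0 1 ≤ ε ∧ p 1 0 ≤ ε := by
    intro ε hε
    obtain ⟨x, y, ⟨hx0, hxε⟩, ⟨hy0, hyε⟩, hQ, -⟩ := hnear (min ε 1) (by positivity)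
    rw [lt_min_iff] at hxε hyε
    have hxy := mul_pos hx0 hy0
    have hle : p 1 1 + p 0 1 * x + p 1 0 * y ≤ x * y := by
      have : 0 ≤ p 1 (-1) * y ^ 2 + p 0 (-1) * x * y ^ 2 + p (-1) (-1) * x ^ 2 * y ^ 2 +
          p 0 0 * x * y + p (-1) 0 * x ^ 2 * y + p (-1) 1 * x ^ 2 := by positivity
      unfold quadCoeff linCoeff constCoeff at hQ
      nlinarith
    have h1 := mul_nonneg p010 hx0.le
    have h2 := mul_nonneg p100 hy0.le
    refine ⟨by nlinarith, ?_, ?_⟩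
    · refine le_trans (le_of_mul_le_mul_right (by linarith) hx0 : p 0 1 ≤ y) hyε.1.le
    · refine le_trans (le_of_mul_le_mul_right (by linarith) hy0 : p 1 0 ≤ x) hxε.1.le
  have e11 : p 1 1 = 0 := eq_zero_of_forall_pos_le p110 fun ε hε => (hcorner ε hε).1
  have e01 : p 0 1 = 0 := eq_zero_of_forall_pos_le p010 fun ε hε => (hcorner ε hε).2.1
  have e10 : p 1 0 = 0 := eq_zero_of_forall_pos_le p100 fun ε hε => (hcorner ε hε).2.2
  have eh : h 1 = 0 := by
    refine eq_zero_of_forall_pos_le h10 fun ε hε => ?_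
    obtain ⟨x, y, ⟨hx0, hxε⟩, -, -, hF⟩ := hnear (min (ε / 2) 1) (by positivity)
    rw [lt_min_iff] at hxε
    set N := boundaryPoly h x with hN
    set B := linCoeff p x with hB
    have hAC : 0 ≤ quadCoeff p x * constCoeff p x := by
      unfold quadCoeff constCoeff; positivity
    have hBx : B ≤ x := by
      rw [hB, linCoeff, e10]
      have : p (-1) 0 * x ^ 2 ≤ x := by nlinarith [mul_nonneg d0 hx0.le]
      nlinarith
    have hN' : -x < N := by
      by_contra! hle
      nlinarith [mul_nonneg (by linarith : 0 ≤ -N) (by linarith : 0 ≤ -(N + B))]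
    rw [hN, boundaryPoly] at hN'
    nlinarith [mul_nonneg h00 hx0.le, mul_nonneg η0 (sq_nonneg x)]
  have hfac : ∃ L F₀ : ℝ, (L < 0 → F₀ ≤ L) ∧ ∀ x, boundaryPoly h x ^ 2 +
      linCoeff p x * boundaryPoly h x + quadCoeff p x * constCoeff p x =
      x ^ 2 * ((x - 1) * (L * x - F₀)) := by
    refine ⟨p (-1) 1 * p (-1) (-1) + h (-1) ^ 2 - h (-1) * p (-1) 0,
      (h (-1) + p (-1) 1) * (h (-1) - p 1 (-1) - p (-1) 0 - p 0 (-1) - p (-1) (-1)) +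
        p 1 (-1) * p (-1) 1, ?_, ?_⟩
    · intro hL
      have hlt : h (-1) ≤ p (-1) 0 := by
        by_contra! hlt
        nlinarith [mul_nonneg c0 g0, mul_nonneg η0 (sub_nonneg.mpr hlt.le)]
      nlinarith [mul_nonneg c0 g0, mul_nonneg c0 e0, mul_nonneg η0 a0, mul_nonneg η0 e0,
        mul_nonneg η0 g0, mul_le_mul_of_nonneg_right hlt c0]
    · intro x
      have eh0 : h 0 = 1 - h (-1) - p (-1) 1 := by linarith
      have e00 : p 0 0 = 1 - p (-1) (-1) - p (-1) 0 - p (-1) 1 - p 0 (-1) - p 1 (-1) := by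
        linarith
      simp only [boundaryPoly, linCoeff, quadCoeff, constCoeff, eh, e11, e01, e10, eh0, e00]
      ring
  obtain ⟨L, F₀, hLF, hF⟩ := hfac
  simp only [hF] at hnear ⊢
  have hlt : ∀ ε > 0, ε ≤ 1 → ∃ x ∈ Set.Ioo 0 ε, F₀ < L * x := by
    intro ε hε hε1
    obtain ⟨x, -, ⟨hx0, hxε⟩, -, -, hneg⟩ := hnear ε hε
    refine ⟨x, ⟨hx0, hxε⟩, ?_⟩
    have h2 : 0 < x ^ 2 := by positivity
    by_contra! hle
    nlinarith [mul_nonneg h2.le (mul_nonneg (by linarith : 0 ≤ 1 - x) (sub_nonneg.mpr hle))]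
  suffices F₀ < L * z by
    have h1 := hz.1
    have h2 := sub_neg.mpr hz.2
    have h3 := sub_pos.mpr this
    exact mul_ne_zero (by positivity) (mul_ne_zero h2.ne h3.ne')
  rcases lt_trichotomy L 0 with hL | hL | hL
  · nlinarith [hLF hL, hz.2]
  · obtain ⟨x, -, hx⟩ := hlt 1 one_pos le_rfl
    rw [hL] at hx ⊢
    linarith
  · obtain ⟨x, hx, hxF⟩ := hlt z hz.1 hz.2.le
    nlinarith [hx.2]

section Flips

variable {p : ℤ → ℤ → ℝ}

theorem flip₂_injective (p : ℤ → ℤ → ℝ) : Function.Injective (flip₂ p) := by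
  rintro ⟨a, b⟩ ⟨c, d⟩ hab
  simp only [flip₂, Prod.mk.injEq] at hab ⊢
  obtain ⟨rfl, h⟩ := hab
  exact ⟨rfl, by linarith⟩

theorem flip₁_injective (p : ℤ → ℤ → ℝ) : Function.Injective (flip₁ p) :=
  Prod.swap_injective.comp ((flip₂_injective (reflectKernel p)).comp Prod.swap_injective)

theorem continuousAt_flip₂ {q : ℝ × ℝ} (hq : quadCoeff p q.1 ≠ 0) :
    ContinuousAt (flip₂ p) q := by
  have hl : Continuous fun q : ℝ × ℝ => linCoeff p q.1 := by unfold linCoeff; fun_prop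
  have ha : Continuous fun q : ℝ × ℝ => quadCoeff p q.1 := by unfold quadCoeff; fun_prop
  exact continuousAt_fst.prodMk
    (continuousAt_snd.neg.sub (hl.continuousAt.div ha.continuousAt hq))

theorem continuousAt_flip₁ {q : ℝ × ℝ} (hq : quadCoeff (reflectKernel p) q.2 ≠ 0) :
    ContinuousAt (flip₁ p) q :=
  continuous_swap.continuousAt.comp
    ((continuousAt_flip₂ (q := q.swap) hq).comp continuous_swap.continuousAt)

theorem flip₂_snd {q : ℝ × ℝ} (hq : quadCoeff p q.1 ≠ 0) :
    (flip₂ p q).2 = q.2 - kernelDeriv p q.1 q.2 / quadCoeff p q.1 := by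
  simp only [flip₂, kernelDeriv]
  field_simp
  ring

theorem flip₁_fst {q : ℝ × ℝ} (hq : quadCoeff (reflectKernel p) q.2 ≠ 0) :
    (flip₁ p q).1 = q.1 - kernelDeriv (reflectKernel p) q.2 q.1 /
      quadCoeff (reflectKernel p) q.2 :=
  flip₂_snd (q := q.swap) hq

theorem kernelDeriv_flip₂ {q : ℝ × ℝ} (hq : quadCoeff p q.1 ≠ 0) :
    kernelDeriv p (flip₂ p q).1 (flip₂ p q).2 = -kernelDeriv p q.1 q.2 := by
  simp only [flip₂, kernelDeriv]
  field_simp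
  ring

theorem kernelDeriv_flip₁ {q : ℝ × ℝ} (hq : quadCoeff (reflectKernel p) q.2 ≠ 0) :
    kernelDeriv (reflectKernel p) (flip₁ p q).2 (flip₁ p q).1 =
      -kernelDeriv (reflectKernel p) q.2 q.1 :=
  kernelDeriv_flip₂ (q := q.swap) hq

theorem continuous_kernelDeriv (p : ℤ → ℤ → ℝ) :
    Continuous fun q : ℝ × ℝ => kernelDeriv p q.1 q.2 := by
  unfold kernelDeriv quadCoeff linCoeff
  fun_prop

theorem continuous_Qf (p : ℤ → ℤ → ℝ) : Continuous fun q : ℝ × ℝ => Qf p q.1 q.2 := by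
  simp only [Qf_eq, quadCoeff, linCoeff, constCoeff]
  fun_prop

/-- Two points of the kernel curve on which the boundary kernel has opposite signs are exchanged
by the flip, and the resultant is negative there. -/
theorem eq_flip_of_boundaryKernel_mul_neg {h : ℤ → ℝ} {x y y' : ℝ} (hA : 0 < quadCoeff p x)
    (hQ : Qf p x y = 0) (hQ' : Qf p x y' = 0)
    (hneg : boundaryKernel p h x y' * boundaryKernel p h x y < 0) :
    (x, y') = flip₂ p (x, y) ∧ boundaryResultant p h x < 0 := by
  rw [Qf_eq] at hQ hQ'
  have hne : y' - y ≠ 0 := by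
    intro h0
    rw [sub_eq_zero.mp h0] at hneg
    exact absurd hneg (not_lt.mpr (mul_self_nonneg _))
  have hsum : quadCoeff p x * (y + y') + linCoeff p x = 0 := by
    apply mul_left_cancel₀ hne
    linear_combination hQ' - hQ
  constructor
  · have hA' := hA.ne'
    simp only [flip₂, Prod.mk.injEq, true_and]
    field_simp
    linear_combination hsum
  · have hprod : quadCoeff p x * (y * y') = constCoeff p x := by
      linear_combination y * hsum - hQ
    convert hneg using 1
    simp only [boundaryResultant, boundaryKernel]
    linear_combination (boundaryPoly h x) * hsum - quadCoeff p x * hprod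

theorem boundaryResultant_eq_zero {h : ℤ → ℝ} {x y : ℝ} (hQ : Qf p x y = 0)
    (hb : boundaryKernel p h x y = 0) : boundaryResultant p h x = 0 := by
  rw [Qf_eq] at hQ
  have hN : boundaryPoly h x = quadCoeff p x * y := by
    unfold boundaryKernel at hb
    linarith
  rw [boundaryResultant, hN]
  linear_combination quadCoeff p x * hQ

theorem finite_boundaryKernel_eq_zero (hp : ∀ s ∈ II, ∀ t ∈ II, 0 ≤ p s t) (hns : Nonsingular p)
    (h : ℤ → ℝ) : {q : ℝ × ℝ | 0 < q.1 ∧ Qf p q.1 q.2 = 0 ∧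
      boundaryKernel p h q.1 q.2 = 0}.Finite := by
  refine Set.Finite.of_finite_image (f := Prod.fst)
    ((hns.finite_boundaryResultant_eq_zero h).subset ?_) ?_
  · rintro _ ⟨q, ⟨-, hQ, hb⟩, rfl⟩
    exact boundaryResultant_eq_zero hQ hb
  · rintro ⟨x, y⟩ ⟨hx, -, hb⟩ ⟨x', y'⟩ ⟨-, -, hb'⟩ hxx
    obtain rfl : x = x' := hxx
    simp only [boundaryKernel] at hx hb hb'
    have := mul_left_cancel₀ (hns.quadCoeff_pos hp hx).ne' (by linarith :
      quadCoeff p x * y = quadCoeff p x * y')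
    rw [this]

end Flips

theorem le_of_mem_derivedSet {X : Type*} [TopologicalSpace X] {S : Set X} {z : X}
    {f g : X → ℝ} (hf : Continuous f) (hg : Continuous g) (hz : z ∈ derivedSet S)
    (hS : ∀ q ∈ S, f q ≤ g q) : f z ≤ g z :=
  closure_minimal hS (isClosed_le hf hg) (derivedSet_subset_closure S hz)

theorem map_mem_derivedSet {X : Type*} [TopologicalSpace X] {τ : X → X}
    (hτ : Function.Injective τ) {S : Set X} {z : X} (hc : ContinuousAt τ z)
    (hz : z ∈ derivedSet S) : τ z ∈ derivedSet (τ '' S) := by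
  simpa using AccPt.map (mem_derivedSet.mp hz) hc hτ

theorem mem_derivedSet_of_union_finite {X : Type*} [TopologicalSpace X] [T1Space X]
    {S T : Set X} (hT : T.Finite) {z : X} (hz : z ∈ derivedSet (T ∪ S)) : z ∈ derivedSet S := by
  rw [derivedSet_union] at hz
  exact hz.resolve_left fun h => Set.Infinite.of_accPt (mem_derivedSet.mp h) hT

section CoupledSets

variable {p : ℤ → ℤ → ℝ} {Γ T : Set (ℝ × ℝ)}

/-- If, up to finitely many exceptions, `Γ` is stable under both flips, then the origin is its only
possible accumulation point. -/
theorem eq_zero_of_mem_derivedSet (hp : ∀ s ∈ II, ∀ t ∈ II, 0 ≤ p s t)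
    (hp1 : ∑ s ∈ II, ∑ t ∈ II, p s t = 1) (hns : Nonsingular p)
    (hdrift : Mx p ≠ 0 ∨ My p ≠ 0)
    (hΓU : Γ ⊆ Set.Ioo (0 : ℝ) 1 ×ˢ Set.Ioo (0 : ℝ) 1)
    (hΓQ : ∀ q ∈ Γ, Qf p q.1 q.2 = 0) (hT : T.Finite)
    (hflip₂ : ∀ q ∈ Γ, q ∉ T → flip₂ p q ∈ Γ) (hflip₁ : ∀ q ∈ Γ, q ∉ T → flip₁ p q ∈ Γ)
    {z₀ : ℝ × ℝ} (hz₀ : z₀ ∈ derivedSet Γ) : z₀ = 0 := by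
  have hnn : ∀ z ∈ derivedSet Γ, 0 ≤ z.1 ∧ 0 ≤ z.2 := fun z hz =>
    ⟨le_of_mem_derivedSet continuous_const continuous_fst hz fun q hq => (hΓU hq).1.1.le,
      le_of_mem_derivedSet continuous_const continuous_snd hz fun q hq => (hΓU hq).2.1.le⟩
  have hle : ∀ z ∈ derivedSet Γ, z.1 ≤ 1 ∧ z.2 ≤ 1 := fun z hz =>
    ⟨le_of_mem_derivedSet continuous_fst continuous_const hz fun q hq => (hΓU hq).1.2.le,
      le_of_mem_derivedSet continuous_snd continuous_const hz fun q hq => (hΓU hq).2.2.le⟩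
  have hcompact : IsCompact (derivedSet Γ) :=
    (isCompact_Icc (a := ((0, 0) : ℝ × ℝ)) (b := (1, 1))).of_isClosed_subset
      (isClosed_derivedSet Γ) fun z hz => ⟨hnn z hz, hle z hz⟩
  obtain ⟨z, hz, hmax⟩ := hcompact.exists_isMaxOn ⟨z₀, hz₀⟩
    (f := fun q : ℝ × ℝ => q.1 + q.2) (by fun_prop)
  have hmax' : ∀ w ∈ derivedSet Γ, w.1 + w.2 ≤ z.1 + z.2 := fun w hw => hmax hw
  by_contra hne
  have hQz : Qf p z.1 z.2 = 0 :=
    closure_minimal (t := {q : ℝ × ℝ | Qf p q.1 q.2 = 0}) hΓQ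
      (isClosed_eq (continuous_Qf p) continuous_const) (derivedSet_subset_closure Γ hz)
  have hsum : 0 < z.1 + z.2 := by
    refine lt_of_lt_of_le ?_ (hmax' z₀ hz₀)
    obtain ⟨h1, h2⟩ := hnn z₀ hz₀
    by_contra! hcon
    exact hne (Prod.ext (by simp; linarith) (by simp; linarith))
  have hp' : ∀ s ∈ II, ∀ t ∈ II, 0 ≤ reflectKernel p s t := fun s hs t ht => hp t ht s hs
  have hz1 : 0 < z.1 := by
    refine (hnn z hz).1.lt_of_ne fun h => ?_
    rw [← h] at hQz hsum
    exact hns.Qf_zero_left_ne_zero hp (by linarith) hQz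
  have hz2 : 0 < z.2 := by
    refine (hnn z hz).2.lt_of_ne fun h => ?_
    rw [← h, ← Qf_reflectKernel] at hQz
    rw [← h] at hsum
    exact hns.reflectKernel.Qf_zero_left_ne_zero hp' (by linarith) hQz
  have hA₂ : ∀ {q : ℝ × ℝ}, 0 < q.1 → 0 < quadCoeff p q.1 := fun h => hns.quadCoeff_pos hp h
  have hA₁ : ∀ {q : ℝ × ℝ}, 0 < q.2 → 0 < quadCoeff (reflectKernel p) q.2 :=
    fun h => hns.reflectKernel.quadCoeff_pos hp' h
  have hcont₂ := continuous_kernelDeriv p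
  have hcont₁ := (continuous_kernelDeriv (reflectKernel p)).comp continuous_swap
  set S₂ : Set (ℝ × ℝ) := {q | q ∈ Γ ∧ q ∉ T ∧ kernelDeriv p q.1 q.2 < 0} with hS₂
  set S₁ : Set (ℝ × ℝ) := {q | q ∈ Γ ∧ q ∉ T ∧ kernelDeriv (reflectKernel p) q.2 q.1 < 0} with hS₁
  have hcover : ∀ q ∈ Γ, q ∈ T ∨ q ∈ S₁ ∨ q ∈ S₂ := by
    intro q hq
    have := kernelDeriv_neg_or_neg hp hp1 hdrift (hΓU hq).1 (hΓU hq).2 (hΓQ q hq)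
    by_cases hqT : q ∈ T
    · exact Or.inl hqT
    · exact Or.inr (this.imp (fun h => ⟨hq, hqT, h⟩) fun h => ⟨hq, hqT, h⟩)
  have hstep₂ : z ∈ derivedSet S₂ → kernelDeriv p z.1 z.2 = 0 ∧ z ∈ derivedSet S₁ := by
    intro hzS
    have hA := hA₂ hz1
    have hD : kernelDeriv p z.1 z.2 ≤ 0 :=
      le_of_mem_derivedSet hcont₂ continuous_const hzS fun q hq => hq.2.2.le
    have hmem := map_mem_derivedSet (flip₂_injective p) (continuousAt_flip₂ hA.ne') hzS
    have hsub : flip₂ p '' S₂ ⊆ Γ := by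
      rintro _ ⟨q, hq, rfl⟩
      exact hflip₂ q hq.1 hq.2.1
    have hle := hmax' _ (derivedSet_mono _ _ hsub hmem)
    have hsnd := flip₂_snd (p := p) (q := z) hA.ne'
    have hfst : (flip₂ p z).1 = z.1 := rfl
    have hdiv : 0 ≤ kernelDeriv p z.1 z.2 / quadCoeff p z.1 := by linarith
    have hD0 : kernelDeriv p z.1 z.2 = 0 := le_antisymm hD (by
      by_contra! hlt
      exact absurd (div_neg_of_neg_of_pos hlt hA) (not_lt.mpr hdiv))
    have hfix : flip₂ p z = z := Prod.ext hfst (by rw [hsnd, hD0]; simp)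
    rw [hfix] at hmem
    refine ⟨hD0, mem_derivedSet_of_union_finite hT (derivedSet_mono _ _ ?_ hmem)⟩
    rintro _ ⟨q, hq, rfl⟩
    have hpos := kernelDeriv_flip₂ (p := p) (hA₂ (hΓU hq.1).1.1).ne'
    rcases hcover _ (hsub ⟨q, hq, rfl⟩) with h | h | h
    · exact Or.inl h
    · exact Or.inr h
    · linarith [h.2.2, hq.2.2]
  have hstep₁ : z ∈ derivedSet S₁ →
      kernelDeriv (reflectKernel p) z.2 z.1 = 0 ∧ z ∈ derivedSet S₂ := by
    intro hzS
    have hA := hA₁ hz2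
    have hD : kernelDeriv (reflectKernel p) z.2 z.1 ≤ 0 :=
      le_of_mem_derivedSet hcont₁ continuous_const hzS fun q hq => hq.2.2.le
    have hmem := map_mem_derivedSet (flip₁_injective p) (continuousAt_flip₁ hA.ne') hzS
    have hsub : flip₁ p '' S₁ ⊆ Γ := by
      rintro _ ⟨q, hq, rfl⟩
      exact hflip₁ q hq.1 hq.2.1
    have hle := hmax' _ (derivedSet_mono _ _ hsub hmem)
    have hfst := flip₁_fst (p := p) (q := z) hA.ne'
    have hsnd : (flip₁ p z).2 = z.2 := rfl
    have hdiv : 0 ≤ kernelDeriv (reflectKernel p) z.2 z.1 / quadCoeff (reflectKernel p) z.2 := by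
      linarith
    have hD0 : kernelDeriv (reflectKernel p) z.2 z.1 = 0 := le_antisymm hD (by
      by_contra! hlt
      exact absurd (div_neg_of_neg_of_pos hlt hA) (not_lt.mpr hdiv))
    have hfix : flip₁ p z = z := Prod.ext (by rw [hfst, hD0]; simp) hsnd
    rw [hfix] at hmem
    refine ⟨hD0, mem_derivedSet_of_union_finite hT (derivedSet_mono _ _ ?_ hmem)⟩
    rintro _ ⟨q, hq, rfl⟩
    have hpos := kernelDeriv_flip₁ (p := p) (hA₁ (hΓU hq.1).2.1).ne'
    rcases hcover _ (hsub ⟨q, hq, rfl⟩) with h | h | h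
    · exact Or.inl h
    · linarith [h.2.2, hq.2.2]
    · exact Or.inr h
  have hboth : kernelDeriv (reflectKernel p) z.2 z.1 = 0 ∧ kernelDeriv p z.1 z.2 = 0 := by
    have hzS : z ∈ derivedSet S₁ ∪ derivedSet S₂ := by
      rw [← derivedSet_union]
      exact mem_derivedSet_of_union_finite hT (derivedSet_mono _ _ hcover hz)
    rcases hzS with h | h
    · exact ⟨(hstep₁ h).1, (hstep₂ (hstep₁ h).2).1⟩
    · exact ⟨(hstep₁ (hstep₂ h).2).1, (hstep₂ h).1⟩
  have := drift_eq_zero_of_kernelDeriv_eq_zero hp hp1 hz1 hz2 hQz hboth.1 hboth.2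
  tauto

/-- A subset of the kernel curve that is stable under both flips and accumulates only at the origin
is empty. -/
theorem eq_empty_of_flip_mem (hp : ∀ s ∈ II, ∀ t ∈ II, 0 ≤ p s t)
    (hp1 : ∑ s ∈ II, ∑ t ∈ II, p s t = 1) (hns : Nonsingular p)
    (hdrift : Mx p ≠ 0 ∨ My p ≠ 0)
    (hΓU : Γ ⊆ Set.Ioo (0 : ℝ) 1 ×ˢ Set.Ioo (0 : ℝ) 1)
    (hΓQ : ∀ q ∈ Γ, Qf p q.1 q.2 = 0)
    (hflip₂ : ∀ q ∈ Γ, flip₂ p q ∈ Γ) (hflip₁ : ∀ q ∈ Γ, flip₁ p q ∈ Γ) : Γ = ∅ := by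
  by_contra! hne
  obtain ⟨q₀, hq₀⟩ := hne
  have hp' : ∀ s ∈ II, ∀ t ∈ II, 0 ≤ reflectKernel p s t := fun s hs t ht => hp t ht s hs
  set S : Set (ℝ × ℝ) := {q | q ∈ Γ ∧ q₀.1 + q₀.2 ≤ q.1 + q.2} with hS
  have hfin : S.Finite := by
    by_contra hinf
    obtain ⟨z, -, hz⟩ := Set.Infinite.exists_accPt_of_subset_isCompact hinf
      (isCompact_Icc (a := ((0, 0) : ℝ × ℝ)) (b := (1, 1))) fun q hq =>
        ⟨⟨(hΓU hq.1).1.1.le, (hΓU hq.1).2.1.le⟩, ⟨(hΓU hq.1).1.2.le, (hΓU hq.1).2.2.le⟩⟩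
    have h0 := eq_zero_of_mem_derivedSet hp hp1 hns hdrift hΓU hΓQ Set.finite_empty
      (fun q hq _ => hflip₂ q hq) (fun q hq _ => hflip₁ q hq)
      (derivedSet_mono _ _ (fun q hq => hq.1) hz)
    have hle : q₀.1 + q₀.2 ≤ z.1 + z.2 :=
      le_of_mem_derivedSet (f := fun _ => q₀.1 + q₀.2) (g := fun q => q.1 + q.2) continuous_const
        (continuous_fst.add continuous_snd) hz fun q hq => hq.2
    rw [h0] at hle
    simp only [Prod.fst_zero, Prod.snd_zero, add_zero] at hle
    linarith [(hΓU hq₀).1.1, (hΓU hq₀).2.1]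
  obtain ⟨q, hq, hmax⟩ := Set.exists_max_image S (fun q => q.1 + q.2) hfin ⟨q₀, hq₀, le_rfl⟩
  have hA₂ := hns.quadCoeff_pos hp (hΓU hq.1).1.1
  have hA₁ := hns.reflectKernel.quadCoeff_pos hp' (hΓU hq.1).2.1
  rcases kernelDeriv_neg_or_neg hp hp1 hdrift (hΓU hq.1).1 (hΓU hq.1).2 (hΓQ q hq.1) with h | h
  · have hfst := flip₁_fst (p := p) hA₁.ne'
    have hsnd : (flip₁ p q).2 = q.2 := rfl
    have hlt := div_neg_of_neg_of_pos h hA₁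
    have := hmax (flip₁ p q) ⟨hflip₁ q hq.1, by linarith [hq.2]⟩
    linarith
  · have hsnd := flip₂_snd (p := p) hA₂.ne'
    have hfst : (flip₂ p q).1 = q.1 := rfl
    have hlt := div_neg_of_neg_of_pos h hA₂
    have := hmax (flip₂ p q) ⟨hflip₂ q hq.1, by linarith [hq.2]⟩
    linarith

/-- There is no infinite set of points of the kernel curve in which every point is compensated
by another one in both boundary balance equations. -/
theorem not_infinite_of_compensated (hp : ∀ s ∈ II, ∀ t ∈ II, 0 ≤ p s t)
    (hp1 : ∑ s ∈ II, ∑ t ∈ II, p s t = 1) (hns : Nonsingular p)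
    (hdrift : Mx p ≠ 0 ∨ My p ≠ 0)
    {h v : ℤ → ℝ} (hh : ∀ s ∈ II, 0 ≤ h s)
    (hh1 : h (-1) + h 0 + h 1 + p (-1) 1 + p 0 1 + p 1 1 = 1) (hv : ∀ t ∈ II, 0 ≤ v t)
    (hv1 : v (-1) + v 0 + v 1 + p 1 (-1) + p 1 0 + p 1 1 = 1)
    (hΓU : Γ ⊆ Set.Ioo (0 : ℝ) 1 ×ˢ Set.Ioo (0 : ℝ) 1)
    (hΓQ : ∀ q ∈ Γ, Qf p q.1 q.2 = 0)
    (hhor : ∀ q ∈ Γ, boundaryKernel p h q.1 q.2 ≠ 0 → ∃ q' ∈ Γ, q'.1 = q.1 ∧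
      boundaryKernel p h q'.1 q'.2 * boundaryKernel p h q.1 q.2 < 0)
    (hver : ∀ q ∈ Γ, boundaryKernel (reflectKernel p) v q.2 q.1 ≠ 0 → ∃ q' ∈ Γ, q'.2 = q.2 ∧
      boundaryKernel (reflectKernel p) v q'.2 q'.1 *
        boundaryKernel (reflectKernel p) v q.2 q.1 < 0) : ¬ Γ.Infinite := by
  intro hinf
  have hp' : ∀ s ∈ II, ∀ t ∈ II, 0 ≤ reflectKernel p s t := fun s hs t ht => hp t ht s hs
  have hp1' : ∑ s ∈ II, ∑ t ∈ II, reflectKernel p s t = 1 := by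
    rw [Finset.sum_comm]
    exact hp1
  have hΓQ' : ∀ q ∈ Γ, Qf (reflectKernel p) q.2 q.1 = 0 := fun q hq => by
    rw [Qf_reflectKernel, hΓQ q hq]
  have hflip₂ : ∀ q ∈ Γ, boundaryKernel p h q.1 q.2 ≠ 0 →
      flip₂ p q ∈ Γ ∧ boundaryResultant p h q.1 < 0 := by
    intro q hq hb
    obtain ⟨⟨x, y'⟩, hq', rfl, hneg⟩ := hhor q hq hb
    obtain ⟨heq, hlt⟩ := eq_flip_of_boundaryKernel_mul_neg
      (hns.quadCoeff_pos hp (hΓU hq).1.1) (hΓQ q hq) (hΓQ (q.1, y') hq') hneg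
    exact ⟨heq ▸ hq', hlt⟩
  have hflip₁ : ∀ q ∈ Γ, boundaryKernel (reflectKernel p) v q.2 q.1 ≠ 0 →
      flip₁ p q ∈ Γ ∧ boundaryResultant (reflectKernel p) v q.2 < 0 := by
    intro q hq hb
    obtain ⟨⟨x', y⟩, hq', rfl, hneg⟩ := hver q hq hb
    obtain ⟨heq, hlt⟩ := eq_flip_of_boundaryKernel_mul_neg
      (hns.reflectKernel.quadCoeff_pos hp' (hΓU hq).2.1) (hΓQ' q hq) (hΓQ' (x', q.2) hq')
      hneg
    refine ⟨?_, hlt⟩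
    have : flip₁ p q = (x', q.2) := congrArg Prod.swap heq.symm
    rwa [this]
  set T : Set (ℝ × ℝ) := {q | q ∈ Γ ∧ (boundaryKernel p h q.1 q.2 = 0 ∨
    boundaryKernel (reflectKernel p) v q.2 q.1 = 0)} with hTdef
  have hT : T.Finite := by
    refine ((finite_boundaryKernel_eq_zero hp hns h).union
      ((finite_boundaryKernel_eq_zero hp' hns.reflectKernel v).preimage
        Prod.swap_injective.injOn)).subset ?_
    rintro q ⟨hq, hb | hb⟩
    · exact Or.inl ⟨(hΓU hq).1.1, hΓQ q hq, hb⟩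
    · exact Or.inr ⟨(hΓU hq).2.1, hΓQ' q hq, hb⟩
  have hnT : ∀ q ∈ Γ, q ∉ T → boundaryKernel p h q.1 q.2 ≠ 0 ∧
      boundaryKernel (reflectKernel p) v q.2 q.1 ≠ 0 := by
    intro q hq hqT
    by_contra hcon
    exact hqT ⟨hq, by tauto⟩
  obtain ⟨z, -, hz⟩ := hinf.exists_accPt_of_subset_isCompact
    (isCompact_Icc (a := ((0, 0) : ℝ × ℝ)) (b := (1, 1))) fun q hq =>
      ⟨⟨(hΓU hq).1.1.le, (hΓU hq).2.1.le⟩, ⟨(hΓU hq).1.2.le, (hΓU hq).2.2.le⟩⟩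
  obtain rfl : z = 0 := eq_zero_of_mem_derivedSet hp hp1 hns hdrift hΓU hΓQ hT
    (fun q hq hqT => (hflip₂ q hq (hnT q hq hqT).1).1)
    (fun q hq hqT => (hflip₁ q hq (hnT q hq hqT).2).1) hz
  have hz' : (0 : ℝ × ℝ) ∈ derivedSet (Γ \ T) :=
    mem_derivedSet_of_union_finite hT (derivedSet_mono _ _ (by simp) hz)
  have hnear : ∀ ε > 0, ∃ q ∈ Γ, q ∉ T ∧ q.1 < ε ∧ q.2 < ε := by
    intro ε hε
    have hU : Set.Iio ε ×ˢ Set.Iio ε ∈ nhds (0 : ℝ × ℝ) :=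
      prod_mem_nhds (Iio_mem_nhds hε) (Iio_mem_nhds hε)
    obtain ⟨q, ⟨hqU, hq⟩, -⟩ := accPt_iff_nhds.mp hz' _ hU
    exact ⟨q, hq.1, hq.2, hqU.1, hqU.2⟩
  have hres₂ : ∀ x ∈ Set.Ioo (0 : ℝ) 1, boundaryResultant p h x ≠ 0 := fun x hx =>
    boundaryResultant_ne_zero hp hp1 hh hh1 (fun ε hε => by
      obtain ⟨q, hq, hqT, h1, h2⟩ := hnear ε hε
      exact ⟨q.1, q.2, ⟨(hΓU hq).1.1, h1⟩, ⟨(hΓU hq).2.1, h2⟩, hΓQ q hq,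
        (hflip₂ q hq (hnT q hq hqT).1).2⟩) hx
  have hres₁ : ∀ y ∈ Set.Ioo (0 : ℝ) 1, boundaryResultant (reflectKernel p) v y ≠ 0 := fun y hy =>
    boundaryResultant_ne_zero hp' hp1' hv hv1 (fun ε hε => by
      obtain ⟨q, hq, hqT, h1, h2⟩ := hnear ε hε
      exact ⟨q.2, q.1, ⟨(hΓU hq).2.1, h2⟩, ⟨(hΓU hq).1.1, h1⟩, hΓQ' q hq,
        (hflip₁ q hq (hnT q hq hqT).2).2⟩) hy
  refine hinf.nonempty.ne_empty (eq_empty_of_flip_mem hp hp1 hns hdrift hΓU hΓQ ?_ ?_)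
  · exact fun q hq => (hflip₂ q hq fun hb =>
      hres₂ _ (hΓU hq).1 (boundaryResultant_eq_zero (hΓQ q hq) hb)).1
  · exact fun q hq => (hflip₁ q hq fun hb =>
      hres₁ _ (hΓU hq).2 (boundaryResultant_eq_zero (hΓQ' q hq) hb)).1

end CoupledSets

/-- The horizontal balance equations for a sum of geometric terms, as a vanishing moment
condition. -/
theorem HorizontalBalance.hasSum_zero {p : ℤ → ℤ → ℝ} {h : ℤ → ℝ} {m : ℕ → ℕ → ℝ}
    (hbh : HorizontalBalance p h m) {ι : Type*} {a x y : ι → ℝ}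
    (hm : ∀ i j, HasSum (fun k => a k * x k ^ i * y k ^ j) (m i j)) (n : ℕ) :
    HasSum (fun k => a k * boundaryKernel p h (x k) (y k) * x k ^ n) 0 := by
  have hb := hbh (n + 1) (by omega)
  have e1 : (((n + 1 : ℕ) : ℤ) - 1).toNat = n := by omega
  have e2 : (((n + 1 : ℕ) : ℤ) - 0).toNat = n + 1 := by omega
  have e3 : (((n + 1 : ℕ) : ℤ) - (-1)).toNat = n + 2 := by omega
  simp only [sum_II, e1, e2, e3] at hb
  have hs := ((((hm (n + 2) 1).mul_right (p (-1) (-1))).add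
    ((hm (n + 1) 1).mul_right (p 0 (-1)))).add ((hm n 1).mul_right (p 1 (-1)))).add
    ((((hm (n + 2) 0).mul_right (h (-1))).add ((hm (n + 1) 0).mul_right (h 0))).add
    ((hm n 0).mul_right (h 1)))
  have hs' := hs.sub (hm (n + 1) 0)
  rw [← hb, sub_self] at hs'
  refine hs'.congr_fun fun k => ?_
  simp only [boundaryKernel, boundaryPoly, quadCoeff]
  ring

/-- If the induced measure with infinitely many geometric terms is the (unique) invariant
measure, then at least one of the coefficients `α(ρ,σ)` is negative. -/
theorem stmt12 (p : ℤ → ℤ → ℝ)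
    (hp : ∀ s ∈ II, ∀ t ∈ II, 0 ≤ p s t)
    (hp1 : ∑ s ∈ II, ∑ t ∈ II, p s t = 1)
    (h : ℤ → ℝ) (hh : ∀ s ∈ II, 0 ≤ h s)
    (hh1 : h (-1) + h 0 + h 1 + p (-1) 1 + p 0 1 + p 1 1 = 1)
    (v : ℤ → ℝ) (hv : ∀ t ∈ II, 0 ≤ v t)
    (hv1 : v (-1) + v 0 + v 1 + p 1 (-1) + p 1 0 + p 1 1 = 1)
    (hns : Nonsingular p)
    (hdrift : Mx p < 0 ∨ My p < 0)
    (hh0 : h 0 < 1) (hv0 : v 0 < 1) (hne : 0 < h 1 + p 1 (-1))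
    (Γ : Set (ℝ × ℝ)) (hΓc : Γ.Countable) (hΓinf : Γ.Infinite)
    (hΓU : Γ ⊆ Set.Ioo (0 : ℝ) 1 ×ˢ Set.Ioo (0 : ℝ) 1)
    (hΓQ : ∀ q ∈ Γ, Qf p q.1 q.2 = 0)
    (α : ℝ × ℝ → ℝ) (hα : ∀ q ∈ Γ, α q ≠ 0)
    (hconv : AbsConv Γ α)
    (hsep : Separation Γ)
    (hpos : ∀ i j : ℕ, 0 < inducedMeasure Γ α i j)
    (hbi : InteriorBalance p (inducedMeasure Γ α))
    (hbh : HorizontalBalance p h (inducedMeasure Γ α))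
    (hbv : VerticalBalance p v (inducedMeasure Γ α))
    (huniq : UniqueInvariant p h v (inducedMeasure Γ α)) :
    ∃ q ∈ Γ, α q < 0 := by
  by_contra! hcon
  have hαpos : ∀ q : Γ, 0 < α q := fun q => (hcon q q.2).lt_of_ne (hα q q.2).symm
  have hm : ∀ i j, HasSum (fun q : Γ => α q * (q : ℝ × ℝ).1 ^ i * (q : ℝ × ℝ).2 ^ j)
      (inducedMeasure Γ α i j) := by
    intro i j
    refine (Summable.of_norm_bounded hconv fun q => ?_).hasSum
    obtain ⟨⟨hx0, hx1⟩, ⟨hy0, hy1⟩⟩ := hΓU q.2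
    rw [norm_mul, norm_mul, Real.norm_eq_abs, norm_pow, norm_pow, Real.norm_of_nonneg hx0.le,
      Real.norm_of_nonneg hy0.le]
    have hx := (pow_le_one₀ (n := i) hx0.le hx1.le).trans
      ((one_le_inv₀ (sub_pos.mpr hx1)).mpr (by linarith))
    have hy := (pow_le_one₀ (n := j) hy0.le hy1.le).trans
      ((one_le_inv₀ (sub_pos.mpr hy1)).mpr (by linarith))
    have := sub_pos.mpr hx1
    gcongr
  have hhor := hbh.hasSum_zero hm
  have hver := HorizontalBalance.hasSum_zero (p := reflectKernel p)
    (m := fun i j => inducedMeasure Γ α j i) hbv (x := fun q : Γ => (q : ℝ × ℝ).2)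
    (y := fun q : Γ => (q : ℝ × ℝ).1) (a := fun q : Γ => α q)
    (fun i j => (hm j i).congr_fun fun q => mul_right_comm _ _ _)
  refine not_infinite_of_compensated hp hp1 hns (hdrift.imp ne_of_lt ne_of_lt) hh hh1 hv hv1
    hΓU hΓQ (fun q hq hb => ?_) (fun q hq hb => ?_) hΓinf
  · obtain ⟨q', h1, h2⟩ :=
      exists_opposite_of_hasSum_zero hαpos (fun q => (hΓU q.2).1) hhor ⟨q, hq⟩ hb
    exact ⟨q', q'.2, h1, h2⟩
  · obtain ⟨q', h1, h2⟩ :=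
      exists_opposite_of_hasSum_zero hαpos (fun q => (hΓU q.2).2) hver ⟨q, hq⟩ hb
    exact ⟨q', q'.2, h1, h2⟩
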